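/- Let P be a set of n > 20 points in general position in the plane ℝ². Let (a, a′) be an 11-edge of P and let D be a 5-hole of P with D ⊆ L(aa′). Then there exist distinct points b, b′ ∈ P such that (b, b′) is an 11-edge of P, b is a vertex of D, and the other four points of D all lie in L(bb′). -/

import Mathlib

open scoped Classical

noncomputable section

/-- A point in the plane. -/
abbrev Pt := ℝ × ℝ

/-- A finite point set is in general position if no three of its points are collinear. -/
def GenPos (P : Finset Pt) : Prop :=
  ∀ S ⊆ P, S.card = 3 → ¬ Collinear ℝ (S : Set Pt)

/-- A finite set is in convex position (its points are vertices of a convex polygon)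
if no point lies in the convex hull of the others. -/
def ConvexPos (S : Finset Pt) : Prop :=
  ∀ x ∈ S, x ∉ convexHull ℝ ((S : Set Pt) \ {x})

/-- `S` is a `k`-hole of `P`: a `k`-element subset of `P` in convex position whose
convex hull contains no point of `P \ S`. -/
def IsHole (k : ℕ) (P S : Finset Pt) : Prop :=
  S ⊆ P ∧ S.card = k ∧ ConvexPos S ∧
    ∀ p ∈ P, p ∈ convexHull ℝ (S : Set Pt) → p ∈ S

/-- The number of `k`-holes of `P`. -/
def numHoles (k : ℕ) (P : Finset Pt) : ℕ :=
  (P.powerset.filter (fun S => IsHole k P S)).card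

/-- `p` lies strictly to the left of the line through `x` and `y`, oriented from `x` to `y`. -/
def leftOf (x y p : Pt) : Prop :=
  0 < (y.1 - x.1) * (p.2 - x.2) - (y.2 - x.2) * (p.1 - x.1)

/-- `(x, y)` is a `j`-edge of `P`: `x, y` are distinct points of `P` and exactly `j`
points of `P` lie strictly to the left of the oriented line `xy`. -/
def IsJEdge (j : ℕ) (P : Finset Pt) (x y : Pt) : Prop :=
  x ∈ P ∧ y ∈ P ∧ x ≠ y ∧ (P.filter (fun p => leftOf x y p)).card = j

/-- Some line strictly separates `A` from `B`. -/
def SepByLine (A B : Set Pt) : Prop :=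
  ∃ u : Pt, u ≠ 0 ∧ ∃ c : ℝ,
    (∀ p ∈ A, u.1 * p.1 + u.2 * p.2 < c) ∧ (∀ q ∈ B, c < u.1 * q.1 + u.2 * q.2)

def crs (v q : Pt) : ℝ := v.1 * q.2 - v.2 * q.1

def rotv (v : Pt) (t : ℝ) : Pt :=
  (Real.cos t * v.1 + Real.sin t * v.2, - Real.sin t * v.1 + Real.cos t * v.2)

theorem crs_par {v q : Pt} (hv : v ≠ 0) (h : crs v q = 0) : ∃ l : ℝ, q = l • v := by
  have hn : v.1 * v.1 + v.2 * v.2 ≠ 0 := by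
    intro h0
    apply hv
    have h1 : v.1 = 0 := by nlinarith [mul_self_nonneg v.1, mul_self_nonneg v.2]
    have h2 : v.2 = 0 := by nlinarith [mul_self_nonneg v.1, mul_self_nonneg v.2]
    exact Prod.ext h1 h2
  unfold crs at h
  refine ⟨(v.1 * q.1 + v.2 * q.2) / (v.1 * v.1 + v.2 * v.2), ?_⟩
  apply Prod.ext
  · simp only [Prod.smul_fst, smul_eq_mul]
    rw [div_mul_eq_mul_div, eq_div_iff hn]
    linear_combination (-v.2) * h
  · simp only [Prod.smul_snd, smul_eq_mul]
    rw [div_mul_eq_mul_div, eq_div_iff hn]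
    linear_combination (v.1) * h

theorem gp_absurd {P : Finset Pt} (hgp : GenPos P) {v x y z : Pt} (hv : v ≠ 0)
    (hx : x ∈ P) (hy : y ∈ P) (hz : z ∈ P) (hxy : x ≠ y) (hxz : x ≠ z) (hyz : y ≠ z)
    (h1 : crs v (y - x) = 0) (h2 : crs v (z - x) = 0) : False := by
  apply hgp {x, y, z}
  · intro p hp
    simp only [Finset.mem_insert, Finset.mem_singleton] at hp
    rcases hp with rfl | rfl | rfl <;> assumption
  · exact Finset.card_eq_three.2 ⟨x, y, z, hxy, hxz, hyz, rfl⟩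
  · obtain ⟨l, hl⟩ := crs_par hv h1
    obtain ⟨m, hm⟩ := crs_par hv h2
    rw [collinear_iff_exists_forall_eq_smul_vadd]
    refine ⟨x, v, ?_⟩
    intro p hp
    simp only [Finset.coe_insert, Finset.coe_singleton, Set.mem_insert_iff,
      Set.mem_singleton_iff] at hp
    rcases hp with rfl | rfl | rfl
    · exact ⟨0, by simp⟩
    · exact ⟨l, by rw [← hl]; simp⟩
    · exact ⟨m, by rw [← hm]; simp⟩

theorem crs_cont (v q : Pt) : Continuous fun t => crs (rotv v t) q := by
  unfold crs rotv
  fun_prop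

theorem stmt_7 (P : Finset Pt) (hcard : 20 < P.card) (hgp : GenPos P)
    (a a' : Pt) (haa' : IsJEdge 11 P a a')
    (D : Finset Pt) (hD : IsHole 5 P D) (hDL : ∀ p ∈ D, leftOf a a' p) :
    ∃ b b' : Pt, b ≠ b' ∧ IsJEdge 11 P b b' ∧ b ∈ D ∧
      ∀ p ∈ D, p ≠ b → leftOf b b' p := by
  obtain ⟨haP, ha'P, hne, hL⟩ := haa'
  obtain ⟨hDP, hD5, -, -⟩ := hD
  set v : Pt := a' - a with hvdef
  have hv : v ≠ 0 := sub_ne_zero.2 hne.symm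
  have hnn : 0 < v.1 * v.1 + v.2 * v.2 := by
    rcases lt_or_eq_of_le (add_nonneg (mul_self_nonneg v.1) (mul_self_nonneg v.2)) with h | h
    · exact h
    · exfalso
      apply hv
      have h1 : v.1 = 0 := by nlinarith [mul_self_nonneg v.1, mul_self_nonneg v.2]
      have h2 : v.2 = 0 := by nlinarith [mul_self_nonneg v.1, mul_self_nonneg v.2]
      exact Prod.ext h1 h2
  have hleft : ∀ x y p, leftOf x y p ↔ 0 < crs (y - x) (p - x) := fun x y p => Iff.rfl
  have hadd : ∀ w p q r : Pt, crs w (p - r) = crs w (p - q) + crs w (q - r) := by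
    intro w p q r
    simp only [crs, Prod.fst_sub, Prod.snd_sub]; ring
  have hneg : ∀ w p q : Pt, crs w (p - q) = - crs w (q - p) := by
    intro w p q
    simp only [crs, Prod.fst_sub, Prod.snd_sub]; ring
  have hrot : ∀ s t, crs (rotv v s) (rotv v t) = (v.1 * v.1 + v.2 * v.2) * Real.sin (s - t) := by
    intro s t
    rw [Real.sin_sub]
    simp only [crs, rotv]; ring
  have hrne : ∀ t, rotv v t ≠ 0 := by
    intro t h0
    have h1 : crs (rotv v (t + Real.pi / 2)) (rotv v t) = 0 := by rw [h0]; simp [crs]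
    rw [hrot] at h1
    simp at h1
    linarith
  have hr0 : rotv v 0 = v := by simp [rotv]
  have hrpi : ∀ q, crs (rotv v Real.pi) q = - crs v q := by
    intro q; simp [rotv, crs]; ring
  let pos : ℝ → Pt → Prop := fun t p => ∃ d ∈ D, 0 < crs (rotv v t) (p - d)
  let S : ℝ → Finset Pt := fun t => (P \ D).filter (pos t)
  have hS : ∀ t p, p ∈ S t ↔ (p ∈ P ∧ p ∉ D) ∧ pos t p := by
    intro t p; simp [S]
  have hS0 : (S 0).card ≤ 6 := by
    have hdis : Disjoint D (S 0) := by
      rw [Finset.disjoint_left]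
      intro p hp hp'
      exact ((hS 0 p).1 hp').1.2 hp
    have hsub : D ∪ S 0 ⊆ P.filter (fun p => leftOf a a' p) := by
      intro p hp
      rw [Finset.mem_filter]
      rcases Finset.mem_union.1 hp with hp | hp
      · exact ⟨hDP hp, hDL p hp⟩
      · obtain ⟨⟨h1, h2⟩, d, hd, h3⟩ := (hS 0 p).1 hp
        refine ⟨h1, ?_⟩
        rw [hr0] at h3
        have h4 := (hleft _ _ _).1 (hDL d hd)
        rw [hleft, hadd _ p d a]
        exact add_pos h3 h4
    have := Finset.card_le_card hsub
    rw [Finset.card_union_of_disjoint hdis] at this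
    omega
  obtain ⟨d0, hd0⟩ : D.Nonempty := by
    rw [← Finset.card_pos]; omega
  have hSpi : 8 ≤ (S Real.pi).card := by
    have hsub : P \ S Real.pi ⊆ P.filter (fun p => leftOf a a' p) := by
      intro p hp
      obtain ⟨hpP, hpS⟩ := Finset.mem_sdiff.1 hp
      rw [Finset.mem_filter]
      refine ⟨hpP, ?_⟩
      by_cases hpD : p ∈ D
      · exact hDL p hpD
      · rw [hS] at hpS
        have h1 : ¬ 0 < crs (rotv v Real.pi) (p - d0) := fun h => hpS ⟨⟨hpP, hpD⟩, d0, hd0, h⟩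
        rw [hrpi] at h1
        have h4 := (hleft _ _ _).1 (hDL d0 hd0)
        rw [hleft, hadd _ p d0 a]
        change 0 < crs v (d0 - a) at h4
        change 0 < crs v (p - d0) + crs v (d0 - a)
        linarith
    have h1 := Finset.card_le_card hsub
    have h2 := Finset.le_card_sdiff (S Real.pi) P
    omega
  let A : Set ℝ := {t | 0 ≤ t ∧ 8 ≤ (S t).card}
  have hApi : Real.pi ∈ A := ⟨Real.pi_pos.le, hSpi⟩
  have hAbd : BddBelow A := ⟨0, fun t ht => ht.1⟩
  set t := sInf A with ht
  have ht0 : 0 ≤ t := le_csInf ⟨_, hApi⟩ (fun s hs => hs.1)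
  -- persistence of strict inequalities
  have hopen : ∀ᶠ s in nhds t, ∀ p ∈ P, ∀ d ∈ D,
      (0 < crs (rotv v t) (p - d) → 0 < crs (rotv v s) (p - d)) ∧
      (crs (rotv v t) (p - d) < 0 → crs (rotv v s) (p - d) < 0) := by
    rw [Filter.eventually_all_finset]
    intro p _
    rw [Filter.eventually_all_finset]
    intro d _
    have hc := (crs_cont v (p - d)).continuousAt (x := t)
    rcases lt_trichotomy (crs (rotv v t) (p - d)) 0 with h | h | h
    · filter_upwards [hc.eventually_lt continuousAt_const h] with s hs
      exact ⟨fun h' => absurd h' (not_lt.2 h.le), fun _ => hs⟩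
    · exact Filter.Eventually.of_forall fun s => ⟨fun h' => absurd h' (by simp [h]), fun h' => absurd h' (by simp [h])⟩
    · filter_upwards [continuousAt_const.eventually_lt hc h] with s hs
      exact ⟨fun _ => hs, fun h' => absurd h' (not_lt.2 h.le)⟩
  obtain ⟨e, he, hball⟩ := Metric.eventually_nhds_iff.1 hopen
  have hSt : (S t).card ≤ 7 := by
    by_contra hcon
    have h8 : 8 ≤ (S t).card := by omega
    have htpos : 0 < t := by
      rcases ht0.lt_or_eq with h | h
      · exact h
      · rw [← h] at h8; omega
    let s := max 0 (t - e / 2)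
    have hst : s < t := max_lt htpos (by linarith)
    have hs0 : 0 ≤ s := le_max_left _ _
    have hse : t - e / 2 ≤ s := le_max_right _ _
    have hs := hball (y := s) (by rw [Real.dist_eq, abs_lt]; constructor <;> linarith)
    have hsub : S t ⊆ S s := by
      intro p hp
      obtain ⟨⟨h1, h2⟩, d, hd, h3⟩ := (hS t p).1 hp
      exact (hS s p).2 ⟨⟨h1, h2⟩, d, hd, (hs p h1 d hd).1 h3⟩
    have := csInf_le hAbd (show s ∈ A from ⟨hs0, h8.trans (Finset.card_le_card hsub)⟩)
    linarith
  obtain ⟨s, hsA, hslt⟩ := exists_lt_of_csInf_lt (s := A) ⟨_, hApi⟩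
    (show sInf A < t + min e Real.pi by have := lt_min he Real.pi_pos; linarith)
  have hts : t < s := by
    rcases (csInf_le hAbd hsA).lt_or_eq with h | h
    · exact h
    · exfalso
      have h1 : t = s := h
      have := hsA.2
      rw [← h1] at this; omega
  have hse : s < t + e := hslt.trans_le (by linarith [min_le_left e Real.pi])
  have hspi : s < t + Real.pi := hslt.trans_le (by linarith [min_le_right e Real.pi])
  have hs := hball (y := s) (by rw [Real.dist_eq, abs_lt]; constructor <;> linarith)
  have hsin : 0 < Real.sin (s - t) := Real.sin_pos_of_pos_of_lt_pi (by linarith) (by linarith)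
  -- a new point
  have hnew : ∃ p ∈ S s, p ∉ S t := by
    by_contra hcon
    push Not at hcon
    have := Finset.card_le_card (show S s ⊆ S t from hcon)
    have := hsA.2
    omega
  have hprop : ∀ p ∈ S s, p ∉ S t → p ∈ P ∧ p ∉ D ∧ (∀ d ∈ D, crs (rotv v t) (p - d) ≤ 0) ∧
      ∃ d ∈ D, 0 < crs (rotv v s) (p - d) ∧ crs (rotv v t) (p - d) = 0 := by
    intro p hp hpt
    obtain ⟨⟨h1, h2⟩, d, hd, h3⟩ := (hS s p).1 hp
    have h4 : ∀ d ∈ D, crs (rotv v t) (p - d) ≤ 0 := by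
      intro d hd
      by_contra hh
      exact hpt ((hS t p).2 ⟨⟨h1, h2⟩, d, hd, not_le.1 hh⟩)
    refine ⟨h1, h2, h4, d, hd, h3, ?_⟩
    rcases (h4 d hd).lt_or_eq with h | h
    · have := (hs p h1 d hd).2 h
      linarith
    · exact h
  obtain ⟨b', hb's, hb't⟩ := hnew
  obtain ⟨hb'P, hb'D, hb'le, b, hbD, hbs, hbt⟩ := hprop b' hb's hb't
  have hbb' : b ≠ b' := fun h => hb'D (h ▸ hbD)
  have hbP := hDP hbD
  have hbt' : crs (rotv v t) (b - b') = 0 := by rw [hneg, hbt, neg_zero]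
  have hDleft : ∀ d ∈ D, d ≠ b → 0 < crs (rotv v t) (d - b) := by
    intro d hd hdb
    have h1 := hb'le d hd
    have h2 := hadd (rotv v t) b' d b
    rcases h1.lt_or_eq with h | h
    · linarith
    · exfalso
      refine gp_absurd hgp (hrne t) hbP hb'P (hDP hd) hbb' hdb.symm ?_ hbt ?_
      · rintro rfl; exact hb'D hd
      · linarith
  obtain ⟨l, hl⟩ := crs_par (hrne t) hbt
  have hlpos : 0 < l := by
    have h1 : crs (rotv v s) (b' - b) = l * crs (rotv v s) (rotv v t) := by
      rw [hl]; simp only [crs, Prod.smul_fst, Prod.smul_snd, smul_eq_mul]; ring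
    rw [h1, hrot] at hbs
    exact (pos_iff_pos_of_mul_pos hbs).2 (mul_pos hnn hsin)
  have hiff : ∀ p, leftOf b b' p ↔ 0 < crs (rotv v t) (p - b) := by
    intro p
    have h1 : crs (b' - b) (p - b) = l * crs (rotv v t) (p - b) := by
      rw [hl]; simp only [crs, Prod.smul_fst, Prod.smul_snd, smul_eq_mul]; ring
    rw [hleft, h1]
    exact mul_pos_iff_of_pos_left hlpos
  have hDge : ∀ d ∈ D, 0 ≤ crs (rotv v t) (d - b) := by
    intro d hd
    by_cases hdb : d = b
    · rw [hdb]; simp [crs]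
    · exact (hDleft d hd hdb).le
  have hSt7 : 7 ≤ (S t).card := by
    have hsub : S s ⊆ insert b' (S t) := by
      intro p hp
      rw [Finset.mem_insert]
      by_contra hcon
      push Not at hcon
      obtain ⟨hpb', hpt⟩ := hcon
      obtain ⟨hpP, hpD, hple, d, hd, -, hdt⟩ := hprop p hp hpt
      have h1 := hple b hbD
      have h2 := hadd (rotv v t) p d b
      have h3 := hDge d hd
      refine gp_absurd hgp (hrne t) hbP hb'P hpP hbb' ?_ hpb'.symm hbt (by linarith)
      rintro rfl; exact hpD hbD
    have h1 := Finset.card_le_card hsub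
    have h2 := Finset.card_insert_le b' (S t)
    have h3 := hsA.2
    omega
  refine ⟨b, b', hbb', ⟨hbP, hb'P, hbb', ?_⟩, hbD, fun p hp hpb => (hiff p).2 (hDleft p hp hpb)⟩
  have heq : P.filter (fun p => leftOf b b' p) = D.erase b ∪ S t := by
    ext p
    rw [Finset.mem_filter, Finset.mem_union, Finset.mem_erase, hS, hiff]
    constructor
    · rintro ⟨h1, h2⟩
      by_cases hpD : p ∈ D
      · left
        refine ⟨?_, hpD⟩
        rintro rfl
        simp [crs] at h2
      · right
        exact ⟨⟨h1, hpD⟩, b, hbD, h2⟩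
    · rintro (⟨h1, h2⟩ | ⟨⟨h1, h2⟩, d, hd, h3⟩)
      · exact ⟨hDP h2, hDleft p h2 h1⟩
      · refine ⟨h1, ?_⟩
        have := hadd (rotv v t) p d b
        have := hDge d hd
        linarith
  have hdis : Disjoint (D.erase b) (S t) := by
    rw [Finset.disjoint_left]
    intro p hp hp'
    exact ((hS t p).1 hp').1.2 (Finset.mem_of_mem_erase hp)
  rw [heq, Finset.card_union_of_disjoint hdis, Finset.card_erase_of_mem hbD]
  omega
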